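/- Let X be a regular curve and f : X → X a monotone continuous map. For every x ∈ X and every negative orbit (x_n)_{n ≥ 0} of x, the set α_f((x_n)_n) of limit points of the sequence (x_n)_{n ≥ 0} is a minimal set of f. -/

import Mathlib

open Set Filter Metric Topology Function

/-- A regular curve: every point has arbitrarily small open neighborhoods
with finite topological boundary (to be used on a compact connected
nonempty metric space, i.e. a continuum). -/
def IsRegCurve (X : Type*) [TopologicalSpace X] : Prop :=
  ∀ (x : X) (V : Set X), IsOpen V → x ∈ V →
    ∃ U : Set X, IsOpen U ∧ x ∈ U ∧ U ⊆ V ∧ (frontier U).Finite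

/-- A monotone continuous self-map: continuous and preimages of connected
sets are connected. -/
def IsMonotoneMap {X : Type*} [TopologicalSpace X] (f : X → X) : Prop :=
  Continuous f ∧ ∀ C : Set X, IsPreconnected C → IsPreconnected (f ⁻¹' C)

/-- The ω-limit set of a point: ⋂ₙ closure {f^k(x) : k ≥ n}. -/
def omegaLimitSet {X : Type*} [TopologicalSpace X] (f : X → X) (x : X) : Set X :=
  ⋂ n : ℕ, closure ((fun k => f^[k] x) '' Set.Ici n)

/-- The α-limit set of a point: ⋂ₖ closure (⋃_{n ≥ k} f⁻ⁿ({x})). -/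
def alphaLimitSet {X : Type*} [TopologicalSpace X] (f : X → X) (x : X) : Set X :=
  ⋂ k : ℕ, closure (⋃ n ∈ Set.Ici k, f^[n] ⁻¹' {x})

/-- limsup of a sequence of sets: ⋂ₖ closure (⋃_{n ≥ k} G n). -/
def limsupSet {X : Type*} [TopologicalSpace X] (G : ℕ → Set X) : Set X :=
  ⋂ k : ℕ, closure (⋃ n ∈ Set.Ici k, G n)

/-- A minimal set of `f`: nonempty, closed, invariant, and with no proper
nonempty closed invariant subset. -/
def IsMinimalSet {X : Type*} [TopologicalSpace X] (f : X → X) (M : Set X) : Prop :=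
  M.Nonempty ∧ IsClosed M ∧ f '' M ⊆ M ∧
    ∀ A : Set X, A ⊆ M → A.Nonempty → IsClosed A → f '' A ⊆ A → A = M

/-- A periodic point of `f`. -/
def IsPeriodicPoint {X : Type*} (f : X → X) (x : X) : Prop :=
  ∃ n : ℕ, 1 ≤ n ∧ f^[n] x = x

/-- The set of limit (cluster) points of a sequence. -/
def seqLimitPoints {X : Type*} [TopologicalSpace X] (u : ℕ → X) : Set X :=
  {y : X | MapClusterPt y Filter.atTop u}


theorem aux_cross {X : Type*} [TopologicalSpace X] {t s : Set X} (ht : IsPreconnected t)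
    (hs : IsOpen s) (h1 : (t ∩ s).Nonempty) (h2 : (t ∩ sᶜ).Nonempty) :
    (t ∩ frontier s).Nonempty := by
  by_contra h
  rw [Set.not_nonempty_iff_eq_empty] at h
  have hsub : t ⊆ s ∪ (closure s)ᶜ := by
    intro x hx
    by_contra hc
    simp only [mem_union, mem_compl_iff, not_or, not_not] at hc
    have : x ∈ t ∩ frontier s := ⟨hx, by rw [hs.frontier_eq]; exact ⟨hc.2, hc.1⟩⟩
    rw [h] at this; exact this
  obtain ⟨b, hbt, hbs⟩ := h2
  have h3 : (t ∩ (closure s)ᶜ).Nonempty :=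
    ⟨b, hbt, (hsub hbt).resolve_left hbs⟩
  obtain ⟨z, -, hz1, hz2⟩ := ht s (closure s)ᶜ hs isClosed_closure.isOpen_compl hsub h1 h3
  exact hz2 (subset_closure hz1)

theorem aux_freq_fin {α β : Type*} {l : Filter α} {S : Set β} (hS : S.Finite)
    {p : β → α → Prop} (h : ∃ᶠ a in l, ∃ s ∈ S, p s a) : ∃ s ∈ S, ∃ᶠ a in l, p s a := by
  by_contra hc
  push Not at hc
  have : ∀ᶠ a in l, ∀ s ∈ S, ¬ p s a := by
    rw [Filter.eventually_all_finite hS]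
    intro s hs
    simpa [Filter.not_frequently] using hc s hs
  apply h
  filter_upwards [this] with a ha
  rintro ⟨s, hs, h⟩
  exact ha s hs h

theorem aux_lc {X : Type*} [MetricSpace X] [CompactSpace X] [ConnectedSpace X]
    (hX : IsRegCurve X) : LocallyConnectedSpace X := by
  rw [locallyConnectedSpace_iff_connected_subsets]
  intro x V hV
  obtain ⟨V1, hV1, hV1c, hV1V⟩ := exists_mem_nhds_isClosed_subset hV
  obtain ⟨U, hUo, hxU, hUV, hfin⟩ := hX x (interior V1) isOpen_interior (mem_interior_iff_mem_nhds.2 hV1)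
  have hclU : closure U ⊆ V :=
    (closure_minimal (hUV.trans interior_subset) hV1c).trans hV1V
  let Y := closure U
  have hYc : IsClosed Y := isClosed_closure
  have : CompactSpace Y := isCompact_iff_compactSpace.1 hYc.isCompact
  let x' : Y := ⟨x, subset_closure hxU⟩
  have hcc := connectedComponent_eq_iInter_isClopen x'
  -- clopen sets separating
  have hsep : ∀ s : Y, s ∉ connectedComponent x' → ∃ Z : Set Y, IsClopen Z ∧ x' ∈ Z ∧ s ∉ Z := by
    intro s hs
    rw [hcc] at hs
    simp only [mem_iInter, Subtype.forall, not_forall] at hs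
    obtain ⟨Z, hZ, hsZ⟩ := hs
    exact ⟨Z, hZ.1, hZ.2, hsZ⟩
  let B : Set Y := (Subtype.val ⁻¹' (frontier U)) \ connectedComponent x'
  have hB : B.Finite := (hfin.preimage Subtype.val_injective.injOn).subset sdiff_subset
  have hZ0 : ∀ s : Y, ∃ Z : Set Y, IsClopen Z ∧ x' ∈ Z ∧ (s ∉ connectedComponent x' → s ∉ Z) := by
    intro s
    by_cases hs : s ∈ connectedComponent x'
    · exact ⟨univ, isClopen_univ, mem_univ _, fun h => absurd hs h⟩
    · obtain ⟨Z, h1, h2, h3⟩ := hsep s hs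
      exact ⟨Z, h1, h2, fun _ => h3⟩
  choose Zf hZ1 hZ2 hZ3 using hZ0
  let Z : Set Y := ⋂ s ∈ B, Zf s
  have hZc : IsClopen Z := hB.isClopen_biInter (fun s _ => hZ1 s)
  have hxZ : x' ∈ Z := mem_iInter₂.2 fun s _ => hZ2 s
  have hZcc : Z ⊆ connectedComponent x' := by
    intro z hz
    rw [hcc]
    simp only [mem_iInter, Subtype.forall]
    rintro Z' ⟨hZ', hxZ'⟩
    by_contra hzZ'
    -- T = Z \ Z' is clopen in Y, avoids frontier
    have hT : IsClopen (Z \ Z') := hZc.diff hZ'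
    have hTU : ∀ t ∈ Z \ Z', (t : X) ∈ U := by
      intro t ht
      by_contra htU
      have htf : (t : X) ∈ frontier U := by
        rw [hUo.frontier_eq]; exact ⟨t.2, htU⟩
      have htc : t ∉ connectedComponent x' := fun h =>
        ht.2 (hZ'.connectedComponent_subset hxZ' h)
      have : t ∈ B := ⟨htf, htc⟩
      exact hZ3 t htc (mem_iInter₂.1 ht.1 t this)
    have hcl : IsClosed (Subtype.val '' (Z \ Z')) := hYc.isClosedEmbedding_subtypeVal.isClosedMap _ hT.1
    have hop : IsOpen (Subtype.val '' (Z \ Z')) := by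
      obtain ⟨O, hO, hOe⟩ := isOpen_induced_iff.1 hT.2
      have : Subtype.val '' (Z \ Z') = O ∩ U := by
        ext w
        constructor
        · rintro ⟨t, ht, rfl⟩
          refine ⟨?_, hTU t ht⟩
          rw [← hOe] at ht; exact ht
        · rintro ⟨h1, h2⟩
          refine ⟨⟨w, subset_closure h2⟩, ?_, rfl⟩
          rw [← hOe]; exact h1
      rw [this]; exact hO.inter hUo
    have huniv := IsClopen.eq_univ ⟨hcl, hop⟩ ⟨z, ⟨z, ⟨hz, hzZ'⟩, rfl⟩⟩
    have hx : x ∈ Subtype.val '' (Z \ Z') := by rw [huniv]; trivial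
    obtain ⟨t, ht, htx⟩ := hx
    have : t = x' := Subtype.ext htx
    exact ht.2 (this ▸ hxZ')
  refine ⟨Subtype.val '' (connectedComponent x'), ?_, ?_, ?_⟩
  · have hop : IsOpen (connectedComponent x') := by
      have : connectedComponent x' = Z :=
        Subset.antisymm (hZc.connectedComponent_subset hxZ) hZcc
      rw [this]; exact hZc.2
    obtain ⟨O, hO, hOe⟩ := isOpen_induced_iff.1 hop
    have hxO : x ∈ O := by
      have : x' ∈ Subtype.val ⁻¹' O := by rw [hOe]; exact mem_connectedComponent
      exact this
    filter_upwards [hO.mem_nhds hxO, hUo.mem_nhds hxU] with w h1 h2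
    refine ⟨⟨w, subset_closure h2⟩, ?_, rfl⟩
    rw [← hOe]; exact h1
  · exact isPreconnected_connectedComponent.image _ continuous_subtype_val.continuousOn
  · rintro _ ⟨t, -, rfl⟩
    exact hclU t.2

theorem aux_germ {X : Type*} [MetricSpace X] [CompactSpace X] [ConnectedSpace X]
    (hX : IsRegCurve X) {D : Set X} (hDo : IsOpen D) (hD : IsPreconnected D) {y : X}
    (hy : y ∉ D) {v : ℕ → X} (hv : Tendsto v atTop (𝓝 y)) (hvD : ∃ᶠ j in atTop, v j ∈ D)
    {C : Set X} (hC : C ∈ 𝓝 y) :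
    ∃ Q, IsPreconnected Q ∧ Q ⊆ C ∧ Q ⊆ D ∧ ∃ᶠ j in atTop, v j ∈ Q := by
  have := aux_lc hX
  obtain ⟨j0, hj0⟩ := hvD.exists
  set d := v j0
  have hdy : y ≠ d := fun h => hy (h ▸ hj0)
  set C' := interior C \ {d}
  have hC'o : IsOpen C' := isOpen_interior.sdiff isClosed_singleton
  have hC' : C' ∈ 𝓝 y := hC'o.mem_nhds ⟨mem_interior_iff_mem_nhds.2 hC, by simpa using hdy⟩
  obtain ⟨V1, hV1, hV1c, hV1V⟩ := exists_mem_nhds_isClosed_subset hC'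
  obtain ⟨U, hUo, hyU, hUV, hfin⟩ := hX y (interior V1) isOpen_interior (mem_interior_iff_mem_nhds.2 hV1)
  have hclU : closure U ⊆ C' :=
    (closure_minimal (hUV.trans interior_subset) hV1c).trans hV1V
  have hDC : IsOpen (D ∩ C') := hDo.inter hC'o
  have key : ∀ p ∈ D, p ∈ U → ∃ s ∈ frontier U, p ∈ connectedComponentIn (D ∩ C') s := by
    intro p hpD hpU
    have hp : p ∈ D ∩ C' := ⟨hpD, hclU (subset_closure hpU)⟩
    set Q := connectedComponentIn (D ∩ C') p with hQ
    have hpQ : p ∈ Q := mem_connectedComponentIn hp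
    have hQo : IsOpen Q := hDC.connectedComponentIn
    have hQs : Q ⊆ D ∩ C' := connectedComponentIn_subset _ _
    have hQp : IsPreconnected Q := isPreconnected_connectedComponentIn
    have hne : (Q ∩ frontier U).Nonempty := by
      apply aux_cross hQp hUo ⟨p, hpQ, hpU⟩
      by_contra hcon
      have hQU : Q ⊆ U := by
        intro q hq
        by_contra hqU
        exact hcon ⟨q, hq, hqU⟩
      have hdQ : d ∉ Q := fun h => (hQs h).2.2 rfl
      obtain ⟨e, heD, hef⟩ := aux_cross hD hQo ⟨p, hpD, hpQ⟩ ⟨d, hj0, hdQ⟩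
      rw [hQo.frontier_eq] at hef
      have heC : e ∈ C' := hclU (closure_mono hQU hef.1)
      have hpre : IsPreconnected (insert e Q) :=
        hQp.subset_closure (subset_insert _ _) (insert_subset hef.1 subset_closure)
      have := hpre.subset_connectedComponentIn (mem_insert_of_mem e hpQ)
        (insert_subset (⟨heD, heC⟩ : e ∈ D ∩ C') hQs)
      exact hef.2 (this (mem_insert _ _))
    obtain ⟨s, hsQ, hsf⟩ := hne
    refine ⟨s, hsf, ?_⟩
    rw [← connectedComponentIn_eq hsQ]; exact hpQ
  have hfr : ∃ᶠ j in atTop, ∃ s ∈ frontier U, v j ∈ connectedComponentIn (D ∩ C') s := by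
    refine (hvD.and_eventually (hv (hUo.mem_nhds hyU))).mono ?_
    rintro j ⟨h1, h2⟩
    exact key _ h1 h2
  obtain ⟨s, -, hs⟩ := aux_freq_fin hfin hfr
  refine ⟨_, isPreconnected_connectedComponentIn, ?_, ?_, hs⟩
  · exact (connectedComponentIn_subset _ _).trans (fun q hq => interior_subset hq.2.1)
  · exact (connectedComponentIn_subset _ _).trans inter_subset_left

theorem aux_iter_pre {X : Type*} [TopologicalSpace X] {f : X → X} (hf : IsMonotoneMap f)
    (n : ℕ) {C : Set X} (hC : IsPreconnected C) : IsPreconnected (f^[n] ⁻¹' C) := by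
  induction n generalizing C with
  | zero => simpa using hC
  | succ n ih =>
    rw [Function.iterate_succ', preimage_comp]
    exact ih (hf.2 C hC)

theorem aux_iter_u {X : Type*} {f : X → X} {u : ℕ → X} (hu : ∀ n : ℕ, f (u (n + 1)) = u n)
    (m n : ℕ) : f^[n] (u (m + n)) = u m := by
  induction n with
  | zero => rfl
  | succ n ih => rw [Function.iterate_succ_apply, ← add_assoc, hu, ih]

theorem aux_pigeon {X : Type*} [TopologicalSpace X] [Nonempty X] {f : X → X}
    (hf : IsMonotoneMap f)
    {W : Set X} (hW : IsOpen W) (hfin : (frontier W).Finite) {Q : Set X} (hQ : IsPreconnected Q)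
    {R : ℕ} (hQR : ∀ r, 1 ≤ r → r ≤ R → ∀ c ∈ Q, f^[r] c ∉ Q)
    {N : Finset ℕ} (hNR : ∀ n ∈ N, ∀ n' ∈ N, n' ≤ n + R)
    (hin : ∀ n ∈ N, ∃ p ∈ W, f^[n] p ∈ Q) (hout : ∀ n ∈ N, ∃ p, p ∉ W ∧ f^[n] p ∈ Q) :
    N.card ≤ hfin.toFinset.card := by
  have : ∀ n : ℕ, n ∈ N → ∃ s, s ∈ frontier W ∧ f^[n] s ∈ Q := by
    intro n hn
    obtain ⟨p, hp, hpQ⟩ := hin n hn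
    obtain ⟨p', hp', hpQ'⟩ := hout n hn
    obtain ⟨s, hs1, hs2⟩ := aux_cross (aux_iter_pre hf n hQ) hW ⟨p, hpQ, hp⟩ ⟨p', hpQ', hp'⟩
    exact ⟨s, hs2, hs1⟩
  choose! s hs1 hs2 using this
  have hlt : ∀ n ∈ N, ∀ n' ∈ N, n < n' → s n ≠ s n' := by
    intro n hn n' hn' hlt he
    have h1 := hs2 n hn
    have h2 := hs2 n' hn'
    rw [← he] at h2
    obtain ⟨r, rfl⟩ := Nat.exists_eq_add_of_lt hlt
    have h3 := hNR n hn _ hn'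
    apply hQR (r + 1) (by omega) (by omega) _ h1
    rw [← Function.iterate_add_apply]
    have : r + 1 + n = n + r + 1 := by omega
    rw [this]; exact h2
  apply Finset.card_le_card_of_injOn s
  · intro n hn
    simpa using hs1 n hn
  · intro n hn n' hn' he
    rcases lt_trichotomy n n' with h | h | h
    · exact absurd he (hlt n hn n' hn' h)
    · exact h
    · exact absurd he.symm (hlt n' hn' n hn h)

theorem aux_sep {X : Type*} [MetricSpace X] [LocallyConnectedSpace X]
    {f : X → X} (hf : Continuous f) {y : X} (R : ℕ)
    (hy : ∀ r, 1 ≤ r → r ≤ R → f^[r] y ≠ y) {V : Set X} (hV : V ∈ 𝓝 y) :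
    ∃ C, IsOpen C ∧ IsPreconnected C ∧ y ∈ C ∧ C ⊆ V ∧
      ∀ r, 1 ≤ r → r ≤ R → ∀ c ∈ C, f^[r] c ∉ C := by
  have h1 : ∀ r ∈ Finset.Icc 1 R, ∃ B ∈ 𝓝 y, ∀ c ∈ B, f^[r] c ∉ B := by
    intro r hr
    rw [Finset.mem_Icc] at hr
    obtain ⟨P, Q, hP, hQ, hyP, hyQ, hd⟩ := t2_separation (hy r hr.1 hr.2)
    refine ⟨Q ∩ f^[r] ⁻¹' P, inter_mem (hQ.mem_nhds hyQ)
      ((hP.preimage (hf.iterate r)).mem_nhds hyP), ?_⟩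
    rintro c ⟨-, hc⟩ ⟨hc', -⟩
    exact disjoint_left.1 hd hc hc'
  choose! B hB1 hB2 using h1
  have hmem : V ∩ ⋂ r ∈ Finset.Icc 1 R, B r ∈ 𝓝 y :=
    inter_mem hV ((Filter.biInter_finset_mem _).2 hB1)
  obtain ⟨C, hCs, hCo, hyC, hCc⟩ :=
    locallyConnectedSpace_iff_subsets_isOpen_isConnected.1 inferInstance y _ hmem
  refine ⟨C, hCo, hCc.isPreconnected, hyC, fun c hc => (hCs hc).1, ?_⟩
  intro r hr1 hr2 c hc hc'
  have hr := Finset.mem_Icc.2 ⟨hr1, hr2⟩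
  exact hB2 r hr c (mem_iInter₂.1 (hCs hc).2 r hr) (mem_iInter₂.1 (hCs hc').2 r hr)

theorem aux_caseI_fin {X : Type*} [TopologicalSpace X] [Nonempty X] {f : X → X}
    (hf : IsMonotoneMap f) {u : ℕ → X} (hu : ∀ n : ℕ, f (u (n + 1)) = u n)
    {W : Set X} (hW : IsOpen W) (hfin : (frontier W).Finite) {R : ℕ}
    (hCl : ∀ t0, ∃ N : Finset ℕ, hfin.toFinset.card < N.card ∧ (∀ n ∈ N, t0 ≤ n ∧ u n ∈ W) ∧
      ∀ n ∈ N, ∀ n' ∈ N, n' ≤ n + R)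
    {μ : ℕ → ℕ} (hμ : ∀ j r, 1 ≤ r → r ≤ j → u (μ j + r) ∉ W)
    {Q : Set X} (hQ : IsPreconnected Q) (hQR : ∀ r, 1 ≤ r → r ≤ R → ∀ c ∈ Q, f^[r] c ∉ Q)
    (hQu : ∃ᶠ j in atTop, u (μ j) ∈ Q) : False := by
  obtain ⟨j', hj'⟩ := hQu.exists
  obtain ⟨N, hN1, hN2, hN3⟩ := hCl (μ j' + 1)
  have hcard : (N.image (fun t => t - μ j')).card = N.card := by
    apply Finset.card_image_of_injOn
    intro a ha b hb hab
    have h1 := (hN2 a ha).1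
    have h2 := (hN2 b hb).1
    simp only at hab
    omega
  have : (N.image (fun t => t - μ j')).card ≤ hfin.toFinset.card := by
    apply aux_pigeon hf hW hfin hQ hQR
    · intro n hn n' hn'
      rw [Finset.mem_image] at hn hn'
      obtain ⟨a, ha, rfl⟩ := hn
      obtain ⟨b, hb, rfl⟩ := hn'
      have h1 := (hN2 a ha).1
      have h2 := (hN2 b hb).1
      have h3 := hN3 a ha b hb
      omega
    · intro n hn
      rw [Finset.mem_image] at hn
      obtain ⟨a, ha, rfl⟩ := hn
      refine ⟨u a, (hN2 a ha).2, ?_⟩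
      have h1 := (hN2 a ha).1
      have h2 := aux_iter_u hu (μ j') (a - μ j')
      rw [show μ j' + (a - μ j') = a by omega] at h2
      rw [h2]; exact hj'
    · intro n hn
      obtain ⟨j, hj, hjQ⟩ := (Filter.frequently_atTop.1 hQu) n
      rw [Finset.mem_image] at hn
      obtain ⟨a, ha, rfl⟩ := hn
      have h1 := (hN2 a ha).1
      refine ⟨u (μ j + (a - μ j')), hμ j _ (by omega) hj, ?_⟩
      rw [aux_iter_u hu]; exact hjQ
  omega

theorem aux_comp {X : Type*} [MetricSpace X] [LocallyConnectedSpace X]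
    {f : X → X} (hf : IsMonotoneMap f) {u : ℕ → X} (hu : ∀ n : ℕ, f (u (n + 1)) = u n)
    {O : Set X} (hO : IsClosed O) (hfO : ∀ p ∈ O, f p ∈ O) {w : X} (hwO : w ∉ O)
    (hw : MapClusterPt w atTop u) {μ : ℕ → ℕ} (hμ : ∀ j, j ≤ μ j) :
    ∃ D, IsOpen D ∧ IsPreconnected D ∧ D ⊆ Oᶜ ∧ ∃ᶠ j in atTop, u (μ j) ∈ D := by
  have hOo : IsOpen Oᶜ := hO.isOpen_compl
  have hDw : connectedComponentIn Oᶜ w ∈ 𝓝 w :=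
    hOo.connectedComponentIn.mem_nhds (mem_connectedComponentIn hwO)
  have hfr := Filter.frequently_atTop.1 (hw.frequently hDw)
  obtain ⟨n, -, hn⟩ := hfr 0
  obtain ⟨m, hm, hmw⟩ := hfr (n + 1)
  have hnO : ∀ i, u (n + i) ∉ O := by
    intro i
    induction i with
    | zero => exact connectedComponentIn_subset _ _ hn
    | succ i ih =>
      intro h
      apply ih
      have := hfO _ h
      rwa [← add_assoc, hu] at this
  have hstep : ∀ a b, u (a + 1) ∉ O → u (b + 1) ∉ O →
      u b ∈ connectedComponentIn Oᶜ (u a) →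
      u (b + 1) ∈ connectedComponentIn Oᶜ (u (a + 1)) := by
    intro a b ha hb hab
    have ha' : u a ∈ Oᶜ := by
      by_contra h
      rw [connectedComponentIn_eq_empty h] at hab
      exact hab
    have hp : IsPreconnected (f ⁻¹' (connectedComponentIn Oᶜ (u a))) :=
      hf.2 _ isPreconnected_connectedComponentIn
    have hs : f ⁻¹' (connectedComponentIn Oᶜ (u a)) ⊆ Oᶜ := fun p hp hpO =>
      connectedComponentIn_subset _ _ hp (hfO p hpO)
    refine hp.subset_connectedComponentIn ?_ hs ?_
    · rw [mem_preimage, hu]; exact mem_connectedComponentIn ha'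
    · rw [mem_preimage, hu]; exact hab
  obtain ⟨e, rfl⟩ := Nat.exists_eq_add_of_le hm
  have hper : ∀ i, u (n + (e + 1) + i) ∈ connectedComponentIn Oᶜ (u (n + i)) := by
    intro i
    induction i with
    | zero =>
      have hn' : u n ∈ connectedComponentIn Oᶜ w := hn
      rw [add_zero n, ← connectedComponentIn_eq hn']
      rw [show n + (e + 1) + 0 = n + 1 + e by omega]
      exact hmw
    | succ i ih =>
      refine hstep (n + i) (n + (e + 1) + i) (hnO (i + 1)) ?_ ih
      rw [show n + (e + 1) + i + 1 = n + (e + 1 + i + 1) by omega]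
      exact hnO _
  have hper2 : ∀ k i, u (n + (e + 1) * k + i) ∈ connectedComponentIn Oᶜ (u (n + i)) := by
    intro k
    induction k with
    | zero => intro i; exact mem_connectedComponentIn (hnO i)
    | succ k ih =>
      intro i
      have h1 := hper i
      have h2 := ih (e + 1 + i)
      rw [show n + (e + 1 + i) = n + (e + 1) + i by omega, ← connectedComponentIn_eq h1] at h2
      rw [show n + (e + 1) * (k + 1) + i = n + (e + 1) * k + (e + 1 + i) by ring]
      exact h2
  have hfr2 : ∃ᶠ j in atTop, ∃ i ∈ Set.Iic e, u (μ j) ∈ connectedComponentIn Oᶜ (u (n + i)) := by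
    apply Filter.Eventually.frequently
    filter_upwards [Filter.eventually_ge_atTop n] with j hj
    refine ⟨(μ j - n) % (e + 1), ?_, ?_⟩
    · exact Nat.lt_succ_iff.1 (Nat.mod_lt (μ j - n) (Nat.succ_pos e))
    · have h := hper2 ((μ j - n) / (e + 1)) ((μ j - n) % (e + 1))
      have h2 := Nat.div_add_mod (μ j - n) (e + 1)
      have h3 := hμ j
      rw [show n + (e + 1) * ((μ j - n) / (e + 1)) + (μ j - n) % (e + 1) = μ j by omega] at h
      exact h
  obtain ⟨i, -, hi⟩ := aux_freq_fin (Set.finite_Iic e) hfr2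
  exact ⟨_, hOo.connectedComponentIn, isPreconnected_connectedComponentIn,
    connectedComponentIn_subset _ _, hi⟩

theorem aux_orbit_fin {X : Type*} {f : X → X} {y : X} {N : ℕ} (hN : 1 ≤ N) (h : f^[N] y = y) :
    (Set.range (fun i => f^[i] y)).Finite := by
  apply ((Set.finite_lt_nat N).image (fun i => f^[i] y)).subset
  rintro _ ⟨i, rfl⟩
  refine ⟨i % N, Nat.mod_lt _ hN, ?_⟩
  exact (show Function.IsPeriodicPt f N y from h).iterate_mod_apply i

theorem aux_caseI {X : Type*} [MetricSpace X] [CompactSpace X] [ConnectedSpace X]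
    (hX : IsRegCurve X) {f : X → X}
    (hf : IsMonotoneMap f) {u : ℕ → X} (hu : ∀ n : ℕ, f (u (n + 1)) = u n)
    {W : Set X} (hW : IsOpen W) (hfin : (frontier W).Finite) {R : ℕ}
    (hCl : ∀ t0, ∃ N : Finset ℕ, hfin.toFinset.card < N.card ∧ (∀ n ∈ N, t0 ≤ n ∧ u n ∈ W) ∧
      ∀ n ∈ N, ∀ n' ∈ N, n' ≤ n + R)
    {μ : ℕ → ℕ} (hμ : ∀ j r, 1 ≤ r → r ≤ j → u (μ j + r) ∉ W) (hμW : ∀ j, u (μ j) ∈ W)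
    (hμj : ∀ j, j ≤ μ j) {y : X} (hy : Tendsto (fun j => u (μ j)) atTop (𝓝 y))
    (hper : ∀ N, 1 ≤ N → f^[N] y = y → ∃ w, MapClusterPt w atTop u ∧ ∀ i, f^[i] y ≠ w) :
    False := by
  have := aux_lc hX
  by_cases hp : ∃ N, 1 ≤ N ∧ f^[N] y = y
  · obtain ⟨N, hN, hNy⟩ := hp
    obtain ⟨w, hw, hwO⟩ := hper N hN hNy
    set O := Set.range (fun i => f^[i] y) with hOdef
    have hOf : O.Finite := aux_orbit_fin hN hNy
    have hyO : y ∈ O := ⟨0, rfl⟩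
    have hfO : ∀ p ∈ O, f p ∈ O := by
      rintro _ ⟨i, rfl⟩
      exact ⟨i + 1, Function.iterate_succ_apply' f i y⟩
    have hwO' : w ∉ O := by
      rintro ⟨i, hi⟩
      exact hwO i hi
    obtain ⟨D, hDo, hDp, hDO, hDu⟩ := aux_comp hf hu hOf.isClosed hfO hwO' hw hμj
    have hyD : y ∉ D := fun h => hDO h hyO
    set B : Set X := (⋃ r ∈ Set.Iic R, f^[r] '' frontier W) \ {y} with hB
    have hBf : B.Finite := ((Set.finite_Iic R).biUnion (fun r _ => hfin.image _)).subset sdiff_subset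
    have hC : Bᶜ ∈ 𝓝 y := hBf.isClosed.isOpen_compl.mem_nhds (fun h => h.2 rfl)
    obtain ⟨Q, hQp, hQC, hQD, hQu⟩ := aux_germ hX hDo hDp hyD hy hDu hC
    have hQF : ∀ r ≤ R, ¬ (f^[r] ⁻¹' Q ∩ frontier W).Nonempty := by
      rintro r hr ⟨s, hs, hsF⟩
      apply hQC hs
      refine ⟨mem_iUnion₂.2 ⟨r, hr, s, hsF, rfl⟩, ?_⟩
      rintro rfl
      exact hyD (hQD hs)
    obtain ⟨j, hj, hjQ⟩ := (Filter.frequently_atTop.1 hQu) R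
    have hQW : Q ⊆ W := by
      intro q hq
      by_contra hqW
      exact hQF 0 (Nat.zero_le _) (aux_cross (aux_iter_pre hf 0 hQp) hW
        ⟨u (μ j), hjQ, hμW j⟩ ⟨q, hq, hqW⟩)
    refine aux_caseI_fin hf hu hW hfin hCl hμ hQp ?_ hQu
    intro r hr1 hr2 c hc hc'
    refine hQF r hr2 (aux_cross (aux_iter_pre hf r hQp) hW ⟨c, hc', hQW hc⟩
      ⟨u (μ j + r), ?_, hμ j r hr1 (hr2.trans hj)⟩)
    rw [mem_preimage, aux_iter_u hu]; exact hjQ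
  · push Not at hp
    obtain ⟨C, hCo, hCp, hyC, -, hCR⟩ := aux_sep hf.1 R (fun r h1 _ => hp r h1)
      (Filter.univ_mem : (univ : Set X) ∈ 𝓝 y)
    exact aux_caseI_fin hf hu hW hfin hCl hμ hCp hCR
      (hy.eventually (hCo.mem_nhds hyC)).frequently

theorem aux_caseII {X : Type*} [MetricSpace X] [CompactSpace X] [ConnectedSpace X]
    (hX : IsRegCurve X) {f : X → X}
    (hf : IsMonotoneMap f) {u : ℕ → X} (hu : ∀ n : ℕ, f (u (n + 1)) = u n)
    {W : Set X} (hW : IsOpen W) (hfin : (frontier W).Finite) {y0 : X} (hy0 : y0 ∈ W)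
    (hy0u : MapClusterPt y0 atTop u)
    (hCl : ¬ ∃ R, ∀ t0, ∃ N : Finset ℕ, hfin.toFinset.card < N.card ∧
      (∀ n ∈ N, t0 ≤ n ∧ u n ∈ W) ∧ ∀ n ∈ N, ∀ n' ∈ N, n' ≤ n + R) : False := by
  have := aux_lc hX
  obtain ⟨𝒰, h𝒰, hlim⟩ := mapClusterPt_iff_ultrafilter.1 hy0u
  have hY : ∀ n : ℕ, ∃ Y, Tendsto (fun m => u (m + n)) 𝒰 (𝓝 Y) := fun n =>
    ⟨_, (𝒰.map (fun m => u (m + n))).le_nhds_lim⟩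
  choose Y hY using hY
  have hYf : ∀ n, f (Y (n + 1)) = Y n := by
    intro n
    refine tendsto_nhds_unique ((hf.1.tendsto _).comp (hY (n + 1))) ?_
    refine (hY n).congr ?_
    intro m
    simp only [Function.comp]
    rw [← add_assoc, hu]
  have hYi := fun m n => aux_iter_u hYf m n
  have hY0 : Y 0 = y0 := tendsto_nhds_unique (hY 0) hlim
  have hS : {n | Y n ∈ W}.Finite := by
    by_contra hinf
    obtain ⟨N, hNs, hNc⟩ := Set.Infinite.exists_subset_card_eq hinf (hfin.toFinset.card + 1)
    apply hCl
    refine ⟨N.sup id, fun t0 => ?_⟩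
    have h1 : ∀ᶠ m in (𝒰 : Filter ℕ), ∀ n ∈ N, u (m + n) ∈ W := by
      rw [Filter.eventually_all_finset]
      intro n hn
      exact (hY n).eventually (hW.mem_nhds (hNs hn))
    obtain ⟨m, hm1, hm2⟩ := (h1.and (h𝒰 (Filter.eventually_ge_atTop t0))).exists
    refine ⟨N.image (fun n => m + n), ?_, ?_, ?_⟩
    · rw [Finset.card_image_of_injective _ (add_right_injective m)]; omega
    · intro n hn
      rw [Finset.mem_image] at hn
      obtain ⟨a, ha, rfl⟩ := hn
      exact ⟨le_add_right hm2, hm1 a ha⟩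
    · intro n hn n' hn'
      rw [Finset.mem_image] at hn hn'
      obtain ⟨a, ha, rfl⟩ := hn
      obtain ⟨b, hb, rfl⟩ := hn'
      have : b ≤ N.sup id := Finset.le_sup (f := id) hb
      omega
  obtain ⟨k, hkW, hkmax⟩ := Set.exists_max_image _ id hS ⟨0, by simpa [hY0] using hy0⟩
  have hkW : Y k ∈ W := hkW
  have hout : ∀ n, 1 ≤ n → Y (k + n) ∉ W := by
    intro n hn h
    have := hkmax (k + n) h
    simp only [id] at this
    omega
  have hnp : ∀ P, 1 ≤ P → f^[P] (Y k) ≠ Y k := by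
    intro P hP hPk
    apply hCl
    set L := hfin.toFinset.card + 1 with hL
    refine ⟨L * P, fun t0 => ?_⟩
    have h1 : ∀ᶠ m in (𝒰 : Filter ℕ), ∀ j ∈ Finset.range L, f^[j * P] (u (m + k)) ∈ W := by
      rw [Filter.eventually_all_finset]
      intro j hj
      have h2 : f^[j * P] (Y k) = Y k := (show Function.IsPeriodicPt f P (Y k) from hPk).const_mul j
      have h3 := (((hf.1.iterate (j * P)).tendsto (Y k)).comp (hY k))
      rw [h2] at h3
      exact h3.eventually (hW.mem_nhds hkW)
    obtain ⟨m, hm1, hm2⟩ := (h1.and (h𝒰 (Filter.eventually_ge_atTop (t0 + L * P)))).exists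
    have hm2 : t0 + L * P ≤ m := hm2
    have hle : ∀ j ∈ Finset.range L, j * P ≤ L * P := fun j hj =>
      Nat.mul_le_mul_right _ (Finset.mem_range.1 hj).le
    refine ⟨(Finset.range L).image (fun j => m + k - j * P), ?_, ?_, ?_⟩
    · rw [Finset.card_image_of_injOn, Finset.card_range]
      · omega
      · intro a ha b hb hab
        have h1 := hle a ha
        have h2 := hle b hb
        simp only at hab
        exact Nat.eq_of_mul_eq_mul_right hP (by omega)
    · intro n hn
      rw [Finset.mem_image] at hn
      obtain ⟨a, ha, rfl⟩ := hn
      have h1 := hle a ha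
      refine ⟨by omega, ?_⟩
      have h3 := aux_iter_u hu (m + k - a * P) (a * P)
      rw [show m + k - a * P + a * P = m + k by omega] at h3
      rw [← h3]; exact hm1 a ha
    · intro n hn n' hn'
      rw [Finset.mem_image] at hn hn'
      obtain ⟨a, ha, rfl⟩ := hn
      obtain ⟨b, hb, rfl⟩ := hn'
      have h1 := hle a ha
      have h2 := hle b hb
      omega
  have hvis : ∀ C ∈ 𝓝 (Y k), ∀ n0, ∃ m ≥ n0, u (m + k) ∈ C := by
    intro C hC n0
    obtain ⟨m, hm1, hm2⟩ := (((hY k).eventually hC).and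
      (h𝒰 (Filter.eventually_ge_atTop n0))).exists
    exact ⟨m, hm2, hm1⟩
  have hq : ∃ q ∈ frontier W, MapClusterPt (Y k) atTop (fun n => f^[n] q) := by
    by_contra hc
    push Not at hc
    have h1 : ∀ q ∈ frontier W, ∃ s ∈ 𝓝 (Y k), ¬ ∃ᶠ n in atTop, f^[n] q ∈ s := by
      intro q hq
      have := hc q hq
      rw [mapClusterPt_iff_frequently] at this
      push Not at this
      obtain ⟨s, hs, h⟩ := this
      exact ⟨s, hs, by rw [Filter.not_frequently]; exact h⟩
    choose! s hs1 hs2 using h1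
    have hV : W ∩ ⋂ q ∈ frontier W, s q ∈ 𝓝 (Y k) :=
      inter_mem (hW.mem_nhds hkW) ((Filter.biInter_mem hfin).2 hs1)
    obtain ⟨C, hCo, hCp, hyC, hCV, -⟩ := aux_sep hf.1 0 (y := Y k) (by intros; omega) hV
    have hfr : ∃ᶠ n in atTop, ∃ q ∈ frontier W, f^[n] q ∈ C := by
      rw [Filter.frequently_atTop]
      intro n0
      obtain ⟨m, -, hm⟩ := hvis C (hCo.mem_nhds hyC) 0
      obtain ⟨m', hm'n, hm'⟩ := hvis C (hCo.mem_nhds hyC) (m + n0 + 1)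
      refine ⟨m' - m, by omega, ?_⟩
      have h2 : f^[m' - m] (u (m' + k)) = u (m + k) := by
        have := aux_iter_u hu (m + k) (m' - m)
        rwa [show m + k + (m' - m) = m' + k by omega] at this
      obtain ⟨q, hq1, hq2⟩ := aux_cross (aux_iter_pre hf (m' - m) hCp) hW
        ⟨u (m' + k), by rw [mem_preimage, h2]; exact hm, (hCV hm').1⟩
        ⟨Y (k + (m' - m)), by rw [mem_preimage, hYi]; exact hyC, hout _ (by omega)⟩
      exact ⟨q, hq2, hq1⟩
    obtain ⟨q, hqF, hq⟩ := aux_freq_fin hfin hfr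
    apply hs2 q hqF
    exact hq.mono (fun n hn => mem_iInter₂.1 (hCV hn).2 q hqF)
  obtain ⟨q, -, hq⟩ := hq
  have hinf := Nat.frequently_atTop_iff_infinite.1 (hq.frequently (hW.mem_nhds hkW))
  obtain ⟨N, hNs, hNc⟩ := Set.Infinite.exists_subset_card_eq hinf (hfin.toFinset.card + 1)
  obtain ⟨C, hCo, hCp, hyC, -, hCR⟩ := aux_sep hf.1 (N.sup id) (y := Y k)
    (fun r h1 _ => hnp r h1) Filter.univ_mem
  obtain ⟨n, hn, hnC⟩ := Filter.frequently_atTop.1 (hq.frequently (hCo.mem_nhds hyC)) (N.sup id + 1)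
  have hnC : f^[n] q ∈ C := hnC
  have hle : ∀ a ∈ N, a ≤ N.sup id := fun a ha => Finset.le_sup (f := id) ha
  have hcard : (N.image (fun a => n - a)).card = N.card := by
    apply Finset.card_image_of_injOn
    intro a ha b hb hab
    have h1 := hle a ha
    have h2 := hle b hb
    simp only at hab
    omega
  have : (N.image (fun a => n - a)).card ≤ hfin.toFinset.card := by
    apply aux_pigeon hf hW hfin hCp hCR
    · intro n hn n' hn'
      rw [Finset.mem_image] at hn hn'
      obtain ⟨a, ha, rfl⟩ := hn
      obtain ⟨b, hb, rfl⟩ := hn'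
      have h1 := hle a ha
      have h2 := hle b hb
      omega
    · intro n' hn'
      rw [Finset.mem_image] at hn'
      obtain ⟨a, ha, rfl⟩ := hn'
      have h1 := hle a ha
      refine ⟨f^[a] q, hNs ha, ?_⟩
      rw [← Function.iterate_add_apply, show n - a + a = n by omega]
      exact hnC
    · intro n' hn'
      rw [Finset.mem_image] at hn'
      obtain ⟨a, ha, rfl⟩ := hn'
      have h1 := hle a ha
      refine ⟨Y (k + (n - a)), hout _ (by omega), ?_⟩
      rw [hYi]; exact hyC
  omega

theorem stmt_17 {X : Type*} [MetricSpace X] [CompactSpace X] [ConnectedSpace X]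
    (hX : IsRegCurve X) (f : X → X) (hf : IsMonotoneMap f) (x : X) (u : ℕ → X)
    (hu0 : u 0 = x) (hu : ∀ n : ℕ, f (u (n + 1)) = u n) :
    IsMinimalSet f (seqLimitPoints u) := by
  refine ⟨?_, isClosed_setOfPred_clusterPt, ?_, ?_⟩
  · obtain ⟨y, -, hy⟩ := isCompact_univ.exists_mapClusterPt (f := atTop) (u := u) (by simp)
    exact ⟨y, hy⟩
  · rintro _ ⟨y, hy, rfl⟩
    have hy : MapClusterPt y atTop u := hy
    have h1 : MapClusterPt (f y) atTop (f ∘ u) := hy.continuousAt_comp hf.1.continuousAt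
    change MapClusterPt (f y) atTop u
    rw [mapClusterPt_iff_frequently] at h1 ⊢
    intro s hs
    have h2 := h1 s hs
    rw [Filter.frequently_atTop] at h2 ⊢
    intro a
    obtain ⟨b, hb, hbs⟩ := h2 (a + 1)
    obtain ⟨c, rfl⟩ : ∃ c, b = c + 1 := ⟨b - 1, by omega⟩
    refine ⟨c, by omega, ?_⟩
    simpa [hu] using hbs
  · intro A hAM ⟨a, ha⟩ hAc hfA
    by_contra hne
    have hMA : ¬ seqLimitPoints u ⊆ A := fun h => hne (Subset.antisymm hAM h)
    obtain ⟨y0, hy0M, hy0A⟩ := Set.not_subset.1 hMA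
    have hy0u : MapClusterPt y0 atTop u := hy0M
    have haI : ∀ i, f^[i] a ∈ A := by
      intro i
      induction i with
      | zero => exact ha
      | succ i ih => rw [Function.iterate_succ_apply']; exact hfA ⟨_, ih, rfl⟩
    obtain ⟨V1, hV1, hV1c, hV1V⟩ :=
      exists_mem_nhds_isClosed_subset (hAc.isOpen_compl.mem_nhds hy0A)
    obtain ⟨W, hW, hy0W, hWV, hfin⟩ :=
      hX y0 (interior V1) isOpen_interior (mem_interior_iff_mem_nhds.2 hV1)
    have hclW : closure W ⊆ Aᶜ :=
      (closure_minimal (hWV.trans interior_subset) hV1c).trans hV1V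
    have hWfr := Filter.frequently_atTop.1 (hy0u.frequently (hW.mem_nhds hy0W))
    have hgap : ∀ J : ℕ, ∃ m, J ≤ m ∧ u m ∈ W ∧ ∀ r, 1 ≤ r → r ≤ J → u (m + r) ∉ W := by
      intro J
      obtain ⟨t, ht, htW⟩ := hWfr J
      have hB : (⋂ i ∈ Finset.range (J + 1), f^[i] ⁻¹' (closure W)ᶜ) ∈ 𝓝 a := by
        rw [Filter.biInter_finset_mem]
        intro i _
        exact (isClosed_closure.isOpen_compl.preimage (hf.1.iterate i)).mem_nhds
          (fun h => hclW h (haI i))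
      have haM : MapClusterPt a atTop u := hAM ha
      obtain ⟨n, hn, hnB⟩ := Filter.frequently_atTop.1 (haM.frequently hB) (t + J)
      have hnB : u n ∈ ⋂ i ∈ Finset.range (J + 1), f^[i] ⁻¹' (closure W)ᶜ := hnB
      have hno : ∀ i ≤ J, u (n - i) ∉ W := by
        intro i hi h
        have h1 := mem_iInter₂.1 hnB i (Finset.mem_range.2 (by omega))
        have h2 := aux_iter_u hu (n - i) i
        rw [show n - i + i = n by omega] at h2
        rw [mem_preimage, h2] at h1
        exact h1 (subset_closure h)
      classical
      let m := Nat.findGreatest (fun i => u i ∈ W) n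
      have hm1 : t ≤ m := Nat.le_findGreatest (by omega) htW
      have hm2 : u m ∈ W := Nat.findGreatest_spec (P := fun i => u i ∈ W) (by omega : t ≤ n) htW
      have hm3 : m ≤ n := Nat.findGreatest_le n
      refine ⟨m, ht.trans hm1, hm2, ?_⟩
      intro r hr1 hr2 hrW
      have hmJ : m + J < n := by
        by_contra hc
        apply hno (n - m) (by omega)
        rw [show n - (n - m) = m by omega]
        exact hm2
      have := Nat.findGreatest_is_greatest (P := fun i => u i ∈ W) (n := n) (k := m + r)
        (by change m < m + r; omega) (by omega)
      exact this hrW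
    by_cases hCl : ∃ R, ∀ t0, ∃ N : Finset ℕ, hfin.toFinset.card < N.card ∧
      (∀ n ∈ N, t0 ≤ n ∧ u n ∈ W) ∧ ∀ n ∈ N, ∀ n' ∈ N, n' ≤ n + R
    · obtain ⟨R, hCl⟩ := hCl
      choose μ hμ1 hμ2 hμ3 using hgap
      obtain ⟨y, φ, hφ, hy⟩ := CompactSpace.tendsto_subseq (fun j => u (μ j))
      refine aux_caseI hX hf hu hW hfin hCl (μ := fun j => μ (φ j)) ?_ (fun j => hμ2 _) ?_ hy ?_
      · intro j r h1 h2
        exact hμ3 (φ j) r h1 (h2.trans (hφ.id_le j))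
      · intro j
        exact (hφ.id_le j).trans (hμ1 _)
      · intro N hN hNy
        by_contra hc
        push Not at hc
        obtain ⟨i, hi⟩ := hc a (hAM ha)
        obtain ⟨k, hk⟩ := hc y0 hy0u
        apply hy0A
        have hp : Function.IsPeriodicPt f N y := hNy
        have : f^[N * i - i + k] a = y0 := by
          rw [← hi, ← Function.iterate_add_apply, ← hk]
          have : i ≤ N * i := Nat.le_mul_of_pos_left i hN
          rw [show N * i - i + k + i = k + N * i by omega, Function.iterate_add_apply,
            (hp.mul_const i).eq]
        rw [← this]; exact haI _
    · exact aux_caseII hX hf hu hW hfin hy0W hy0u hCl
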